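/- Each of the six variables a, b, c, d, e, f lies in the subfield of K = ℚ(a,b,c,d,e,f) generated over ℚ by the eight line coordinates s_1, t_1, s_2, t_2, s_3, t_3, s_*, t_* of the four Pascal lines ℓ_1, ℓ_2, ℓ_3, ℓ_*. Equivalently, ℚ(s_1,t_1,s_2,t_2,s_3,t_3,s_*,t_*) = ℚ(a,b,c,d,e,f). -/

import Mathlib

noncomputable section

/-- `K = ℚ(a,b,c,d,e,f)`, the field of rational functions in six variables over ℚ. -/
abbrev RatField : Type := FractionRing (MvPolynomial (Fin 6) ℚ)

/-- The six independent variables `a, b, c, d, e, f` (indexed `0,…,5`) as elements of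
`ℚ(a,…,f)`. -/
def var (i : Fin 6) : RatField :=
  algebraMap (MvPolynomial (Fin 6) ℚ) RatField (MvPolynomial.X i)

/-- The point `[1, p, p²]` of the conic `z1² = z0·z2`, in homogeneous coordinates. -/
def conicPt (p : RatField) : Fin 3 → RatField := ![1, p, p ^ 2]

/-- Cross product of coordinate vectors: the coordinates of the join of two points, or of
the intersection of two lines. -/
def cross (u v : Fin 3 → RatField) : Fin 3 → RatField :=
  ![u 1 * v 2 - u 2 * v 1, u 2 * v 0 - u 0 * v 2, u 0 * v 1 - u 1 * v 0]

/-- The homogeneous coordinate vector of the Pascal line of the array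
`[P1 P2 P3; Q1 Q2 Q3]` of points of the conic with parameters `p1, p2, p3, q1, q2, q3`:
the line through the (collinear) points `P1Q2 ∩ P2Q1`, `P2Q3 ∩ P3Q2`, `P1Q3 ∩ P3Q1`,
computed as the join of the first two of them. -/
def pascalVec (p1 p2 p3 q1 q2 q3 : RatField) : Fin 3 → RatField :=
  cross
    (cross (cross (conicPt p1) (conicPt q2)) (cross (conicPt p2) (conicPt q1)))
    (cross (cross (conicPt p2) (conicPt q3)) (cross (conicPt p3) (conicPt q2)))

/-- The coordinate `s` of a line with coordinates `⟨1, s, t⟩`, i.e. the line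
`z0 + s·z1 + t·z2 = 0`. -/
def sCoord (l : Fin 3 → RatField) : RatField := l 1 / l 0

/-- The coordinate `t` of a line with coordinates `⟨1, s, t⟩`, i.e. the line
`z0 + s·z1 + t·z2 = 0`. -/
def tCoord (l : Fin 3 → RatField) : RatField := l 2 / l 0

/-- The Pascal `ℓ₁` of the array `[A D B; E C F]`. -/
def line1 : Fin 3 → RatField := pascalVec (var 0) (var 3) (var 1) (var 4) (var 2) (var 5)

/-- The Pascal `ℓ₂` of the array `[A C F; E D B]`. -/
def line2 : Fin 3 → RatField := pascalVec (var 0) (var 2) (var 5) (var 4) (var 3) (var 1)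

/-- The Pascal `ℓ₃` of the array `[A D F; E C B]`. -/
def line3 : Fin 3 → RatField := pascalVec (var 0) (var 3) (var 5) (var 4) (var 2) (var 1)

/-- The Pascal `ℓ⋆` of the array `[A B C; F D E]`. -/
def lineStar : Fin 3 → RatField :=
  pascalVec (var 0) (var 1) (var 2) (var 5) (var 3) (var 4)

/-- If `L` is generated over a subfield `F` by a root of a quadratic polynomial, then there is no
field strictly between `F` and `L`. -/
theorem Subfield.eq_top_of_adjoin_root_quadratic {L : Type*} [Field L] {F E : Subfield L}
    (hFE : F ≤ E) {α x q₀ q₁ q₂ : L} (h₀ : q₀ ∈ F) (h₁ : q₁ ∈ F) (h₂ : q₂ ∈ F) (hq : q₂ ≠ 0)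
    (hroot : q₂ * α ^ 2 + q₁ * α + q₀ = 0) (hgen : IntermediateField.adjoin F {α} = ⊤)
    (hxE : x ∈ E) (hxF : x ∉ F) : E = ⊤ := by
  let p : Polynomial F := .C ⟨q₂, h₂⟩ * .X ^ 2 + .C ⟨q₁, h₁⟩ * .X + .C ⟨q₀, h₀⟩
  have hlead : (⟨q₂, h₂⟩ : F) ≠ 0 := fun h => hq (congrArg Subtype.val h)
  have hdeg : p.natDegree = 2 := Polynomial.natDegree_quadratic hlead
  have hp : p ≠ 0 := by
    rintro h
    simp [h] at hdeg
  have hmap (y : F) : algebraMap F L y = y := rfl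
  have hpα : Polynomial.aeval α p = 0 := by
    simpa [p, hmap] using hroot
  have hint : IsIntegral F α := IsAlgebraic.isIntegral ⟨p, hp, hpα⟩
  have hfin : FiniteDimensional F L := by
    have := IntermediateField.adjoin.finiteDimensional hint
    rw [hgen] at this
    exact IntermediateField.topEquiv.toLinearEquiv.finiteDimensional
  have hrank : Module.finrank F L ≤ 2 := by
    have h := IntermediateField.adjoin.finrank hint
    rw [hgen, IntermediateField.finrank_top'] at h
    rw [h, ← hdeg]
    exact Polynomial.natDegree_le_of_dvd (minpoly.dvd F α hpα) hp
  let M : IntermediateField F L := Subfield.extendScalars hFE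
  have hM : Module.finrank F M ≠ 1 := by
    intro h
    rw [IntermediateField.finrank_eq_one_iff] at h
    have hx : x ∈ M := hxE
    rw [h, IntermediateField.mem_bot] at hx
    obtain ⟨y, rfl⟩ := hx
    exact hxF y.2
  have hpos : 0 < Module.finrank F M := Module.finrank_pos
  have htop : M = ⊤ := by
    refine IntermediateField.eq_of_le_of_finrank_le le_top ?_
    rw [IntermediateField.finrank_top']
    omega
  rw [eq_top_iff]
  intro y _
  have : y ∈ M := htop ▸ IntermediateField.mem_top
  exact this

/-- A subfield of `ℚ(a,…,f)` containing the six variables is everything. -/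
theorem eq_top_of_var_mem {E : Subfield RatField} (h : ∀ i, var i ∈ E) : E = ⊤ := by
  have hpoly : ∀ p : MvPolynomial (Fin 6) ℚ, algebraMap _ RatField p ∈ E := by
    intro p
    induction p using MvPolynomial.induction_on with
    | C q =>
      rw [← MvPolynomial.algebraMap_eq, ← IsScalarTower.algebraMap_apply, eq_ratCast]
      exact SubfieldClass.ratCast_mem E q
    | add p q hp hq => rw [map_add]; exact add_mem hp hq
    | mul_X p i hp => rw [map_mul]; exact mul_mem hp (h i)
  rw [eq_top_iff]
  intro x _
  obtain ⟨p, q, -, rfl⟩ := IsFractionRing.div_surjective (A := MvPolynomial (Fin 6) ℚ) x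
  exact div_mem (hpoly p) (hpoly q)

theorem algebraMap_ne_zero_of_eval (v : Fin 6 → ℚ) {p : MvPolynomial (Fin 6) ℚ}
    (h : MvPolynomial.eval v p ≠ 0) : algebraMap _ RatField p ≠ 0 := by
  rw [Ne, IsFractionRing.to_map_eq_zero_iff]
  rintro rfl
  simp at h

theorem var_injective : Function.Injective var := fun _ _ h =>
  MvPolynomial.X_injective (IsFractionRing.injective _ RatField h)

/-- The automorphism of `ℚ(a,…,f)` exchanging `a ↔ e`, `b ↔ f` and `c ↔ d`. -/
def swap : RatField ≃+* RatField :=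
  IsFractionRing.ringEquivOfRingEquiv
    (MvPolynomial.renameEquiv ℚ (⟨![4, 5, 3, 2, 0, 1], ![4, 5, 3, 2, 0, 1], by decide, by decide⟩ :
      Fin 6 ≃ Fin 6)).toRingEquiv

theorem swap_var (i : Fin 6) : swap (var i) = var (![4, 5, 3, 2, 0, 1] i) := by
  simp [swap, var]

theorem map_pascalVec (φ : RatField →+* RatField) (p1 p2 p3 q1 q2 q3 : RatField) (i : Fin 3) :
    φ (pascalVec p1 p2 p3 q1 q2 q3 i) =
      pascalVec (φ p1) (φ p2) (φ p3) (φ q1) (φ q2) (φ q3) i := by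
  fin_cases i <;> simp [pascalVec, cross, conicPt]

theorem pascalVec_swap_rows (p1 p2 p3 q1 q2 q3 : RatField) :
    pascalVec q1 q2 q3 p1 p2 p3 = pascalVec p1 p2 p3 q1 q2 q3 := by
  ext i
  fin_cases i <;> simp [pascalVec, cross, conicPt] <;> ring

/-- The point where the chords `pq` and `rs` of the conic meet lies on the line `l`. -/
def ChordsMeetOn (p q r s : RatField) (l : Fin 3 → RatField) : Prop :=
  (p + q - r - s) * l 0 + (p * q - r * s) * l 1 +
    (p * q * (r + s) - r * s * (p + q)) * l 2 = 0

theorem pascalVec_chords₁₂ (p1 p2 p3 q1 q2 q3 : RatField) :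
    ChordsMeetOn p1 q2 p2 q1 (pascalVec p1 p2 p3 q1 q2 q3) := by
  simp [ChordsMeetOn, pascalVec, cross, conicPt]; ring

theorem pascalVec_chords₂₃ (p1 p2 p3 q1 q2 q3 : RatField) :
    ChordsMeetOn p2 q3 p3 q2 (pascalVec p1 p2 p3 q1 q2 q3) := by
  simp [ChordsMeetOn, pascalVec, cross, conicPt]; ring

theorem pascalVec_chords₁₃ (p1 p2 p3 q1 q2 q3 : RatField) :
    ChordsMeetOn p1 q3 p3 q1 (pascalVec p1 p2 p3 q1 q2 q3) := by
  simp [ChordsMeetOn, pascalVec, cross, conicPt]; ring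

/-- The affine coordinate `z1 / z0` of the point where the chords `pq` and `rs` meet. -/
def chordX (p q r s : RatField) : RatField := (p * q - r * s) / (p + q - r - s)

/-- The affine coordinate `z2 / z0` of the point where the chords `pq` and `rs` meet. -/
def chordY (p q r s : RatField) : RatField :=
  (p * q * (r + s) - r * s * (p + q)) / (p + q - r - s)

theorem chord_incidence_left {p q r s : RatField} (h : p + q - r - s ≠ 0) :
    p * q - (p + q) * chordX p q r s + chordY p q r s = 0 := by
  rw [chordX, chordY]
  field_simp
  ring

theorem chord_incidence_right {p q r s : RatField} (h : p + q - r - s ≠ 0) :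
    s * r - (s + r) * chordX p q r s + chordY p q r s = 0 := by
  rw [chordX, chordY]
  field_simp
  ring

theorem left_ne_chordX {p q r s : RatField} (h : p + q - r - s ≠ 0) (hr : p ≠ r)
    (hs : p ≠ s) : p ≠ chordX p q r s := by
  rw [← sub_ne_zero]
  have : p - chordX p q r s = (p - r) * (p - s) / (p + q - r - s) := by
    rw [chordX]
    field_simp
    ring
  rw [this]
  exact div_ne_zero (mul_ne_zero (sub_ne_zero.2 hr) (sub_ne_zero.2 hs)) h

theorem right_ne_chordX {p q r s : RatField} (h : p + q - r - s ≠ 0) (hp : s ≠ p)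
    (hq : s ≠ q) : s ≠ chordX p q r s := by
  rw [← sub_ne_zero]
  have : s - chordX p q r s = -((s - p) * (s - q)) / (p + q - r - s) := by
    rw [chordX]
    field_simp
    ring
  rw [this]
  exact div_ne_zero (neg_ne_zero.2 (mul_ne_zero (sub_ne_zero.2 hp) (sub_ne_zero.2 hq))) h

/-- A field containing a point `[1, x, y]` on a chord of the conic and one endpoint of this chord
contains the other endpoint. -/
theorem mem_of_chord {E : Subfield RatField} {p q x y : RatField}
    (h : p * q - (p + q) * x + y = 0) (hpx : p ≠ x) (hx : x ∈ E) (hy : y ∈ E) (hp : p ∈ E) :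
    q ∈ E := by
  have hq : q * (p - x) = p * x - y := by linear_combination h
  rw [eq_div_of_mul_eq (sub_ne_zero.2 hpx) hq]
  exact div_mem (sub_mem (mul_mem hp hx) hy) (sub_mem hp hx)

/-- A field containing the affine coordinates of two lines contains those of their common point. -/
theorem chord_mem_of_lines {E : Subfield RatField} {p q r s : RatField} {l m : Fin 3 → RatField}
    (h : p + q - r - s ≠ 0) (hl : ChordsMeetOn p q r s l) (hm : ChordsMeetOn p q r s m)
    (hl₀ : l 0 ≠ 0) (hm₀ : m 0 ≠ 0) (hdet : l 1 * m 2 - l 2 * m 1 ≠ 0)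
    (hsl : sCoord l ∈ E) (htl : tCoord l ∈ E) (hsm : sCoord m ∈ E) (htm : tCoord m ∈ E) :
    chordX p q r s ∈ E ∧ chordY p q r s ∈ E := by
  have hl' : 1 + sCoord l * chordX p q r s + tCoord l * chordY p q r s = 0 := by
    rw [sCoord, tCoord, chordX, chordY]
    rw [ChordsMeetOn] at hl
    field_simp
    linear_combination hl
  have hm' : 1 + sCoord m * chordX p q r s + tCoord m * chordY p q r s = 0 := by
    rw [sCoord, tCoord, chordX, chordY]
    rw [ChordsMeetOn] at hm
    field_simp
    linear_combination hm
  have hd : sCoord l * tCoord m - tCoord l * sCoord m ≠ 0 := by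
    have : sCoord l * tCoord m - tCoord l * sCoord m =
        (l 1 * m 2 - l 2 * m 1) / (l 0 * m 0) := by
      rw [sCoord, tCoord, sCoord, tCoord]
      field_simp
    rw [this]
    exact div_ne_zero hdet (mul_ne_zero hl₀ hm₀)
  have hdE := sub_mem (mul_mem hsl htm) (mul_mem htl hsm)
  constructor
  · have : chordX p q r s * (sCoord l * tCoord m - tCoord l * sCoord m) =
        tCoord l - tCoord m := by
      linear_combination tCoord m * hl' - tCoord l * hm'
    rw [eq_div_of_mul_eq hd this]
    exact div_mem (sub_mem htl htm) hdE
  · have : chordY p q r s * (sCoord l * tCoord m - tCoord l * sCoord m) =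
        sCoord m - sCoord l := by
      linear_combination sCoord l * hm' - sCoord m * hl'
    rw [eq_div_of_mul_eq hd this]
    exact div_mem (sub_mem hsm hsl) hdE

theorem swap_sCoord (l : Fin 3 → RatField) : swap (sCoord l) = sCoord (swap ∘ l) := by
  simp [sCoord]

theorem swap_tCoord (l : Fin 3 → RatField) : swap (tCoord l) = tCoord (swap ∘ l) := by
  simp [tCoord]

theorem swap_comp_pascalVec (p1 p2 p3 q1 q2 q3 : RatField) :
    swap ∘ pascalVec p1 p2 p3 q1 q2 q3 =
      pascalVec (swap p1) (swap p2) (swap p3) (swap q1) (swap q2) (swap q3) :=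
  funext (map_pascalVec swap.toRingHom p1 p2 p3 q1 q2 q3)

theorem swap_comp_line1 : swap ∘ line1 = line1 := by
  rw [line1, swap_comp_pascalVec]
  simp only [swap_var]
  exact pascalVec_swap_rows ..

theorem swap_comp_line2 : swap ∘ line2 = line2 := by
  rw [line2, swap_comp_pascalVec]
  simp only [swap_var]
  exact pascalVec_swap_rows ..

theorem swap_comp_line3 : swap ∘ line3 = line3 := by
  rw [line3, swap_comp_pascalVec]
  simp only [swap_var]
  exact pascalVec_swap_rows ..

theorem swap_comp_lineStar :
    swap ∘ lineStar = pascalVec (var 4) (var 5) (var 3) (var 1) (var 2) (var 0) := by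
  rw [lineStar, swap_comp_pascalVec]
  simp only [swap_var]
  rfl

theorem chord_denominator_ne_zero {i j k l : Fin 6} (hj : i ≠ j) (hk : i ≠ k) (hl : i ≠ l) :
    var i + var j - var k - var l ≠ 0 := by
  simp only [var, ← map_add, ← map_sub]
  refine algebraMap_ne_zero_of_eval (Pi.single i 1) ?_
  simp [Pi.single_eq_of_ne, hj.symm, hk.symm, hl.symm]

theorem line1_zero_ne_zero : line1 0 ≠ 0 := by
  simp only [line1, pascalVec, cross, conicPt, var, Matrix.cons_val,
    ← map_one (algebraMap (MvPolynomial (Fin 6) ℚ) RatField), ← map_sub, ← map_mul, ← map_pow]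
  refine algebraMap_ne_zero_of_eval ![1, 2, 5, -3, 11, 7] ?_
  simp
  norm_num

theorem line2_zero_ne_zero : line2 0 ≠ 0 := by
  simp only [line2, pascalVec, cross, conicPt, var, Matrix.cons_val,
    ← map_one (algebraMap (MvPolynomial (Fin 6) ℚ) RatField), ← map_sub, ← map_mul, ← map_pow]
  refine algebraMap_ne_zero_of_eval ![1, 2, 5, -3, 11, 7] ?_
  simp
  norm_num

theorem line3_zero_ne_zero : line3 0 ≠ 0 := by
  simp only [line3, pascalVec, cross, conicPt, var, Matrix.cons_val,
    ← map_one (algebraMap (MvPolynomial (Fin 6) ℚ) RatField), ← map_sub, ← map_mul, ← map_pow]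
  refine algebraMap_ne_zero_of_eval ![1, 2, 5, -3, 11, 7] ?_
  simp
  norm_num

theorem lineStar_zero_ne_zero : lineStar 0 ≠ 0 := by
  simp only [lineStar, pascalVec, cross, conicPt, var, Matrix.cons_val,
    ← map_one (algebraMap (MvPolynomial (Fin 6) ℚ) RatField), ← map_sub, ← map_mul, ← map_pow]
  refine algebraMap_ne_zero_of_eval ![1, 2, 5, -3, 11, 7] ?_
  simp
  norm_num

theorem line1_line2_det_ne_zero : line1 1 * line2 2 - line1 2 * line2 1 ≠ 0 := by
  simp only [line1, line2, pascalVec, cross, conicPt, var, Matrix.cons_val,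
    ← map_one (algebraMap (MvPolynomial (Fin 6) ℚ) RatField), ← map_sub, ← map_mul, ← map_pow]
  refine algebraMap_ne_zero_of_eval ![1, 2, 5, -3, 11, 7] ?_
  simp
  norm_num

theorem line1_line3_det_ne_zero : line1 1 * line3 2 - line1 2 * line3 1 ≠ 0 := by
  simp only [line1, line3, pascalVec, cross, conicPt, var, Matrix.cons_val,
    ← map_one (algebraMap (MvPolynomial (Fin 6) ℚ) RatField), ← map_sub, ← map_mul, ← map_pow]
  refine algebraMap_ne_zero_of_eval ![1, 2, 5, -3, 11, 7] ?_
  simp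
  norm_num

theorem line2_line3_det_ne_zero : line2 1 * line3 2 - line2 2 * line3 1 ≠ 0 := by
  simp only [line2, line3, pascalVec, cross, conicPt, var, Matrix.cons_val,
    ← map_one (algebraMap (MvPolynomial (Fin 6) ℚ) RatField), ← map_sub, ← map_mul, ← map_pow]
  refine algebraMap_ne_zero_of_eval ![1, 2, 5, -3, 11, 7] ?_
  simp
  norm_num

theorem lineStar_det_swap_ne_zero :
    pascalVec (var 4) (var 5) (var 3) (var 1) (var 2) (var 0) 2 * lineStar 0 -
      lineStar 2 * pascalVec (var 4) (var 5) (var 3) (var 1) (var 2) (var 0) 0 ≠ 0 := by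
  simp only [lineStar, pascalVec, cross, conicPt, var, Matrix.cons_val,
    ← map_one (algebraMap (MvPolynomial (Fin 6) ℚ) RatField), ← map_sub, ← map_mul, ← map_pow]
  refine algebraMap_ne_zero_of_eval ![1, 2, 5, -3, 11, 7] ?_
  simp
  norm_num

/-- The leading coefficient of the quadratic equation satisfied by `a` and `e` is nonzero. -/
theorem leading_coeff_ne_zero :
    chordX (var 0) (var 2) (var 3) (var 4) * chordX (var 0) (var 1) (var 5) (var 4) -
      (chordX (var 0) (var 2) (var 3) (var 4) + chordX (var 0) (var 1) (var 5) (var 4)) *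
        chordX (var 2) (var 1) (var 5) (var 3) + chordY (var 2) (var 1) (var 5) (var 3) ≠ 0 := by
  have hX : var 2 + var 1 - var 5 - var 3 ≠ 0 :=
    chord_denominator_ne_zero (by decide) (by decide) (by decide)
  have hY : var 0 + var 2 - var 3 - var 4 ≠ 0 :=
    chord_denominator_ne_zero (by decide) (by decide) (by decide)
  have hZ : var 0 + var 1 - var 5 - var 4 ≠ 0 :=
    chord_denominator_ne_zero (by decide) (by decide) (by decide)
  have hnum : (var 0 * var 2 - var 3 * var 4) * (var 0 * var 1 - var 5 * var 4) *
        (var 2 + var 1 - var 5 - var 3) -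
      ((var 0 * var 2 - var 3 * var 4) * (var 0 + var 1 - var 5 - var 4) +
        (var 0 * var 1 - var 5 * var 4) * (var 0 + var 2 - var 3 - var 4)) *
          (var 2 * var 1 - var 5 * var 3) +
      (var 2 * var 1 * (var 5 + var 3) - var 5 * var 3 * (var 2 + var 1)) *
        (var 0 + var 2 - var 3 - var 4) * (var 0 + var 1 - var 5 - var 4) ≠ 0 := by
    simp only [var, ← map_add, ← map_sub, ← map_mul]
    refine algebraMap_ne_zero_of_eval ![1, 2, 5, -3, 11, 7] ?_
    simp
    norm_num
  intro h
  apply hnum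
  simp only [chordX, chordY] at h
  field_simp at h
  linear_combination h

/-- Eliminating `β` and `γ` from three involutive relations gives a quadratic equation for `α`. -/
theorem quadratic_of_involutions {α β γ x₁ x₂ y₁ y₂ z₁ z₂ : RatField}
    (hX : β * γ - (β + γ) * x₁ + x₂ = 0) (hY : α * β - (α + β) * y₁ + y₂ = 0)
    (hZ : α * γ - (α + γ) * z₁ + z₂ = 0) :
    (y₁ * z₁ - (y₁ + z₁) * x₁ + x₂) * α ^ 2 +
      (x₁ * (2 * y₁ * z₁ + y₂ + z₂) - (y₁ * z₂ + y₂ * z₁) - x₂ * (y₁ + z₁)) * α +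
      (y₂ * z₂ - x₁ * (y₂ * z₁ + z₂ * y₁) + x₂ * y₁ * z₁) = 0 := by
  linear_combination (α - y₁) * (α - z₁) * hX - (γ * (α - z₁) - x₁ * (α - z₁)) * hY -
    ((α * y₁ - y₂) - x₁ * (α - y₁)) * hZ

/-- Each of the six variables `a, …, f` lies in the subfield of `K = ℚ(a,…,f)` generated
over ℚ by the eight line coordinates `s₁, t₁, s₂, t₂, s₃, t₃, s⋆, t⋆` of the four Pascal
lines `ℓ₁, ℓ₂, ℓ₃, ℓ⋆`; equivalently `ℚ(s₁,t₁,s₂,t₂,s₃,t₃,s⋆,t⋆) = ℚ(a,…,f)`.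
(Every subfield of `K` contains `ℚ`, so `Subfield.closure` of the eight coordinates is
the subfield they generate over `ℚ`.) -/
theorem pascal_stmt_0 :
    ∀ i : Fin 6,
      var i ∈ Subfield.closure
        {sCoord line1, tCoord line1, sCoord line2, tCoord line2,
          sCoord line3, tCoord line3, sCoord lineStar, tCoord lineStar} := by
  let E := Subfield.closure
    {sCoord line1, tCoord line1, sCoord line2, tCoord line2,
      sCoord line3, tCoord line3, sCoord lineStar, tCoord lineStar}
  let S : Set RatField :=
    {sCoord line1, tCoord line1, sCoord line2, tCoord line2, sCoord line3, tCoord line3}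
  let F := Subfield.closure S
  have hFE : F ≤ E := Subfield.closure_mono (by
    simp only [S, Set.insert_subset_iff, Set.singleton_subset_iff, Set.mem_insert_iff,
      Set.mem_singleton_iff, true_or, or_true, and_self])
  have mem {x : RatField} (hx : x ∈ S) : x ∈ F := Subfield.subset_closure hx
  have hs₁ : sCoord line1 ∈ F := mem (by simp [S])
  have ht₁ : tCoord line1 ∈ F := mem (by simp [S])
  have hs₂ : sCoord line2 ∈ F := mem (by simp [S])
  have ht₂ : tCoord line2 ∈ F := mem (by simp [S])
  have hs₃ : sCoord line3 ∈ F := mem (by simp [S])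
  have ht₃ : tCoord line3 ∈ F := mem (by simp [S])
  have hX : var 2 + var 1 - var 5 - var 3 ≠ 0 :=
    chord_denominator_ne_zero (by decide) (by decide) (by decide)
  have hY : var 0 + var 2 - var 3 - var 4 ≠ 0 :=
    chord_denominator_ne_zero (by decide) (by decide) (by decide)
  have hZ : var 0 + var 1 - var 5 - var 4 ≠ 0 :=
    chord_denominator_ne_zero (by decide) (by decide) (by decide)
  have hX₁ : ChordsMeetOn (var 2) (var 1) (var 5) (var 3) line1 := by
    have h : ChordsMeetOn (var 3) (var 5) (var 1) (var 2) line1 := pascalVec_chords₂₃ ..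
    rw [ChordsMeetOn] at h ⊢
    linear_combination -h
  obtain ⟨hx₁, hx₂⟩ := chord_mem_of_lines hX hX₁ (pascalVec_chords₂₃ ..) line1_zero_ne_zero
    line2_zero_ne_zero line1_line2_det_ne_zero hs₁ ht₁ hs₂ ht₂
  obtain ⟨hy₁, hy₂⟩ := chord_mem_of_lines hY (pascalVec_chords₁₂ ..) (pascalVec_chords₁₂ ..)
    line1_zero_ne_zero line3_zero_ne_zero line1_line3_det_ne_zero hs₁ ht₁ hs₃ ht₃
  obtain ⟨hz₁, hz₂⟩ := chord_mem_of_lines hZ (pascalVec_chords₁₃ ..) (pascalVec_chords₁₃ ..)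
    line2_zero_ne_zero line3_zero_ne_zero line2_line3_det_ne_zero hs₂ ht₂ hs₃ ht₃
  have hquad := quadratic_of_involutions (chord_incidence_left hX) (chord_incidence_left hY)
    (chord_incidence_left hZ)
  have hquad' := quadratic_of_involutions
    (by linear_combination chord_incidence_right hX : var 3 * var 5 - (var 3 + var 5) *
      chordX (var 2) (var 1) (var 5) (var 3) + chordY (var 2) (var 1) (var 5) (var 3) = 0)
    (chord_incidence_right hY) (chord_incidence_right hZ)
  have hlead := leading_coeff_ne_zero
  have ne {i j : Fin 6} (hij : i ≠ j) : var i ≠ var j := var_injective.ne hij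
  generalize chordX (var 2) (var 1) (var 5) (var 3) = x₁ at *
  generalize chordY (var 2) (var 1) (var 5) (var 3) = x₂ at *
  have hay := left_ne_chordX hY (ne (by decide)) (ne (by decide))
  have haz := left_ne_chordX hZ (ne (by decide)) (ne (by decide))
  have hey := right_ne_chordX hY (ne (by decide)) (ne (by decide))
  have hez := right_ne_chordX hZ (ne (by decide)) (ne (by decide))
  have hac := chord_incidence_left hY
  have hab := chord_incidence_left hZ
  have hed := chord_incidence_right hY
  have hef := chord_incidence_right hZ
  generalize chordX (var 0) (var 2) (var 3) (var 4) = y₁ at *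
  generalize chordY (var 0) (var 2) (var 3) (var 4) = y₂ at *
  generalize chordX (var 0) (var 1) (var 5) (var 4) = z₁ at *
  generalize chordY (var 0) (var 1) (var 5) (var 4) = z₂ at *
  set q₂ := y₁ * z₁ - (y₁ + z₁) * x₁ + x₂
  set q₁ := x₁ * (2 * y₁ * z₁ + y₂ + z₂) - (y₁ * z₂ + y₂ * z₁) - x₂ * (y₁ + z₁)
  set q₀ := y₂ * z₂ - x₁ * (y₂ * z₁ + z₂ * y₁) + x₂ * y₁ * z₁
  have hq₂ : q₂ ∈ F := add_mem (sub_mem (mul_mem hy₁ hz₁) (mul_mem (add_mem hy₁ hz₁) hx₁)) hx₂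
  have hq₁ : q₁ ∈ F :=
    sub_mem (sub_mem (mul_mem hx₁ (add_mem (add_mem
      (mul_mem (mul_mem (ofNat_mem F 2) hy₁) hz₁) hy₂) hz₂))
      (add_mem (mul_mem hy₁ hz₂) (mul_mem hy₂ hz₁))) (mul_mem hx₂ (add_mem hy₁ hz₁))
  have hq₀ : q₀ ∈ F :=
    add_mem (sub_mem (mul_mem hy₂ hz₂) (mul_mem hx₁ (add_mem (mul_mem hy₂ hz₁)
      (mul_mem hz₂ hy₁)))) (mul_mem (mul_mem hx₂ hy₁) hz₁)
  have hvieta : var 4 = -q₁ / q₂ - var 0 := by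
    have h : (var 0 - var 4) * (q₂ * (var 0 + var 4) + q₁) = 0 := by
      linear_combination hquad - hquad'
    have h' := (mul_eq_zero.1 h).resolve_left (sub_ne_zero.2 (ne (by decide)))
    field_simp
    linear_combination h'
  have hgen : IntermediateField.adjoin F {var 0} = ⊤ := by
    let M := IntermediateField.adjoin F {var 0}
    have hFM {x : RatField} (hx : x ∈ F) : x ∈ M.toSubfield := M.algebraMap_mem ⟨x, hx⟩
    have ha : var 0 ∈ M.toSubfield := IntermediateField.mem_adjoin_simple_self F (var 0)
    have he : var 4 ∈ M.toSubfield := by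
      rw [hvieta]
      exact sub_mem (hFM (div_mem (neg_mem hq₁) hq₂)) ha
    have hM : M.toSubfield = ⊤ := by
      refine eq_top_of_var_mem fun i => ?_
      fin_cases i
      · exact ha
      · exact mem_of_chord hab haz (hFM hz₁) (hFM hz₂) ha
      · exact mem_of_chord hac hay (hFM hy₁) (hFM hy₂) ha
      · exact mem_of_chord hed hey (hFM hy₁) (hFM hy₂) he
      · exact he
      · exact mem_of_chord hef hez (hFM hz₁) (hFM hz₂) he
    exact IntermediateField.toSubfield_injective (hM.trans IntermediateField.top_toSubfield.symm)
  have hfix : F ≤ swap.toRingHom.eqLocusField (RingHom.id _) := by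
    refine Subfield.closure_le.2 ?_
    rintro x (rfl | rfl | rfl | rfl | rfl | rfl)
    · exact (swap_sCoord _).trans (congrArg _ swap_comp_line1)
    · exact (swap_tCoord _).trans (congrArg _ swap_comp_line1)
    · exact (swap_sCoord _).trans (congrArg _ swap_comp_line2)
    · exact (swap_tCoord _).trans (congrArg _ swap_comp_line2)
    · exact (swap_sCoord _).trans (congrArg _ swap_comp_line3)
    · exact (swap_tCoord _).trans (congrArg _ swap_comp_line3)
  have htF : tCoord lineStar ∉ F := by
    intro h
    have h₀ : (swap ∘ lineStar) 0 ≠ 0 :=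
      (map_ne_zero_iff swap swap.injective).2 lineStar_zero_ne_zero
    have h' : tCoord (swap ∘ lineStar) = tCoord lineStar := (swap_tCoord _).symm.trans (hfix h)
    rw [tCoord, tCoord, div_eq_div_iff h₀ lineStar_zero_ne_zero, swap_comp_lineStar] at h'
    exact lineStar_det_swap_ne_zero (sub_eq_zero.2 h')
  have htE : tCoord lineStar ∈ E := Subfield.subset_closure (by simp)
  have htop : E = ⊤ :=
    Subfield.eq_top_of_adjoin_root_quadratic hFE hq₀ hq₁ hq₂ hlead hquad hgen htE htF
  intro i
  change var i ∈ E
  rw [htop]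
  exact Subfield.mem_top _

end
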